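/- There exists an absolute constant C > 0 such that for all integers 2 ≤ k ≤ n with n ≥ 2 and every real 1 < δ ≤ 2, there exists a δ-balanced (n,k)-family of perfect hash functions of size at most 2^{C·(k·log k + log(1/(δ−1)))}·log n. -/

import Mathlib

open Finset

attribute [local instance] Classical.propDecidable

/-- The number of functions in the family `F` that are injective on the set `S`. -/
noncomputable def injCount {n k N : ℕ} (F : Fin N → Fin n → Fin k) (S : Finset (Fin n)) : ℕ :=
  (Finset.univ.filter fun i => Set.InjOn (F i) ↑S).card

/-- `F` is a `δ`-balanced `(n,k)`-family of perfect hash functions. -/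
noncomputable def IsBalancedFamily {n k N : ℕ} (δ : ℝ) (F : Fin N → Fin n → Fin k) : Prop :=
  ∃ T : ℝ, 0 < T ∧ ∀ S : Finset (Fin n), S.card = k →
    T / δ ≤ (injCount F S : ℝ) ∧ (injCount F S : ℝ) ≤ δ * T

theorem sum_exp_sum_le {Ω : Type*} [Fintype Ω] (y : Ω → ℝ) (hy : ∀ ω, |y ω| ≤ 1)
    (hsum : ∑ ω, y ω = 0) (t : ℝ) (ht : |t| ≤ 1) (N : ℕ) :
    ∑ F : Fin N → Ω, Real.exp (t * ∑ j, y (F j)) ≤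
      (Fintype.card Ω : ℝ) ^ N * Real.exp (t ^ 2 * N) := by
  have h1 : ∑ F : Fin N → Ω, Real.exp (t * ∑ j, y (F j)) = (∑ ω, Real.exp (t * y ω)) ^ N := by
    rw [Fintype.sum_pow]
    exact sum_congr rfl fun F _ => by rw [mul_sum, Real.exp_sum]
  have h2 : ∑ ω, Real.exp (t * y ω) ≤ Fintype.card Ω * Real.exp (t ^ 2) := by
    calc ∑ ω, Real.exp (t * y ω) ≤ ∑ ω, (1 + t ^ 2 + t * y ω) := by
          refine sum_le_sum fun ω _ => ?_
          have hty : |t * y ω| ≤ 1 := by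
            rw [abs_mul]
            exact mul_le_one₀ ht (abs_nonneg _) (hy ω)
          have h3 := (abs_le.1 (Real.abs_exp_sub_one_sub_id_le hty)).2
          have h4 : (y ω) ^ 2 ≤ 1 := (sq_le_one_iff_abs_le_one _).2 (hy ω)
          nlinarith [mul_le_mul_of_nonneg_left h4 (sq_nonneg t)]
      _ = Fintype.card Ω * (1 + t ^ 2) := by
          rw [sum_add_distrib, ← mul_sum, hsum]
          simp [mul_add]
      _ ≤ _ := by
          gcongr
          linarith [Real.add_one_le_exp (t ^ 2)]
  rw [h1, mul_comm (t ^ 2), Real.exp_nat_mul, ← mul_pow]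
  exact pow_le_pow_left₀ (sum_nonneg fun _ _ => (Real.exp_pos _).le) h2 N

/-- If every set `A i` has density `p`, some sequence of `N` points visits all of them with
frequency within `l` of `p`, provided `N` is large compared with the logarithm of their number. -/
theorem exists_seq_card_near {Ω ι : Type*} [Fintype Ω] [Nonempty Ω] (I : Finset ι)
    (A : ι → Finset Ω) (p l : ℝ) (hp0 : 0 ≤ p) (hp1 : p ≤ 1) (hl0 : 0 ≤ l) (hl1 : l ≤ 1)
    (hA : ∀ i ∈ I, ((A i).card : ℝ) = p * Fintype.card Ω) (N : ℕ)
    (hN : 2 * (I.card : ℝ) < Real.exp (l ^ 2 / 4 * N)) :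
    ∃ F : Fin N → Ω, ∀ i ∈ I, |((univ.filter fun j => F j ∈ A i).card : ℝ) - p * N| ≤ l * N := by
  by_contra! hcon
  set y : ι → Ω → ℝ := fun i ω => (if ω ∈ A i then 1 else 0) - p with hy
  have hsumF : ∀ i (F : Fin N → Ω),
      ∑ j, y i (F j) = ((univ.filter fun j => F j ∈ A i).card : ℝ) - p * N := by
    intro i F
    simp [hy, sum_sub_distrib, sum_boole, mul_comm]
  have hy1 : ∀ i ω, |y i ω| ≤ 1 := by
    intro i ω
    simp only [hy, abs_le]
    split_ifs <;> constructor <;> linarith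
  have hy0 : ∀ i ∈ I, ∑ ω, y i ω = 0 := by
    intro i hi
    simp [hy, sum_sub_distrib, hA i hi, mul_comm]
  set c : ℝ := (Fintype.card Ω : ℝ) ^ N with hc
  have hcpos : 0 < c := by
    have : 0 < Fintype.card Ω := Fintype.card_pos
    positivity
  have hlow : c * Real.exp (l / 2 * (l * N)) ≤
      ∑ F : Fin N → Ω, ∑ i ∈ I,
        (Real.exp (l / 2 * ∑ j, y i (F j)) + Real.exp (-(l / 2) * ∑ j, y i (F j))) := by
    have hcard : c * Real.exp (l / 2 * (l * N)) =
        ∑ _F : Fin N → Ω, Real.exp (l / 2 * (l * N)) := by simp [hc]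
    rw [hcard]
    refine sum_le_sum fun F _ => ?_
    obtain ⟨i, hi, hdev⟩ := hcon F
    rw [← hsumF] at hdev
    refine le_trans ?_ (single_le_sum (f := fun i => Real.exp (l / 2 * ∑ j, y i (F j)) +
      Real.exp (-(l / 2) * ∑ j, y i (F j))) (fun _ _ => by positivity) hi)
    rcases lt_abs.1 hdev with h | h
    · have : Real.exp (l / 2 * (l * N)) ≤ Real.exp (l / 2 * ∑ j, y i (F j)) := by gcongr
      linarith [Real.exp_pos (-(l / 2) * ∑ j, y i (F j))]
    · have : Real.exp (l / 2 * (l * N)) ≤ Real.exp (-(l / 2) * ∑ j, y i (F j)) := by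
        rw [neg_mul_comm]
        gcongr
      linarith [Real.exp_pos (l / 2 * ∑ j, y i (F j))]
  have habs : |l / 2| ≤ 1 := by rw [abs_of_nonneg (by linarith)]; linarith
  have hup : ∑ F : Fin N → Ω, ∑ i ∈ I,
      (Real.exp (l / 2 * ∑ j, y i (F j)) + Real.exp (-(l / 2) * ∑ j, y i (F j))) ≤
      c * (2 * I.card * Real.exp (l ^ 2 / 4 * N)) := by
    rw [sum_comm]
    calc _ ≤ ∑ i ∈ I, 2 * (c * Real.exp (l ^ 2 / 4 * N)) := by
          refine sum_le_sum fun i hi => ?_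
          rw [sum_add_distrib]
          have h1 := sum_exp_sum_le (y i) (hy1 i) (hy0 i hi) (l / 2) habs N
          have h2 := sum_exp_sum_le (y i) (hy1 i) (hy0 i hi) (-(l / 2)) (by rwa [abs_neg]) N
          rw [neg_sq] at h2
          rw [show (l / 2) ^ 2 = l ^ 2 / 4 by ring] at h1 h2
          linarith
      _ = _ := by rw [sum_const, nsmul_eq_mul]; ring
  have hfin := le_of_mul_le_mul_left (hlow.trans hup) hcpos
  rw [show l / 2 * (l * N) = l ^ 2 / 4 * N + l ^ 2 / 4 * N by ring, Real.exp_add] at hfin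
  exact absurd (le_of_mul_le_mul_right hfin (Real.exp_pos _)) (not_le.2 hN)

theorem card_filter_injOn {n k : ℕ} (S : Finset (Fin n)) (hS : S.card = k) :
    (univ.filter fun f : Fin n → Fin k => Set.InjOn f ↑S).card = k.factorial * k ^ (n - k) := by
  let e := Equiv.piEquivPiSubtypeProd (fun x => x ∈ S) (fun _ : Fin n => Fin k)
  have h1 : {f : Fin n → Fin k // Set.InjOn f ↑S} ≃
      ({x // x ∈ S} ↪ Fin k) × ({x // x ∉ S} → Fin k) :=
    (e.subtypeEquiv (q := fun g => Function.Injective g.1) fun f => by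
      rw [Set.injOn_iff_injective]; rfl).trans
      ((Equiv.prodSubtypeFstEquivSubtypeProd (p := Function.Injective)).trans
        (Equiv.prodCongrLeft fun _ => Equiv.subtypeInjectiveEquivEmbedding _ _))
  rw [← Fintype.card_subtype, Fintype.card_congr h1, Fintype.card_prod,
    Fintype.card_embedding_eq, Fintype.card_fun]
  simp [hS, Nat.descFactorial_self, Fintype.card_subtype_compl]

theorem size_bound {k : ℕ} (hk : 2 ≤ k) {ε L : ℝ} (hε0 : 0 < ε) (hε1 : ε ≤ 1) (hL : 1 ≤ L) :
    16 * (k + 1) * ((k : ℝ) ^ k) ^ 2 / ε ^ 2 * L + 1 ≤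
      2 ^ ((6 : ℝ) * ((k : ℝ) * Real.logb 2 k + Real.logb 2 (1 / ε))) * L := by
  have hk' : (2 : ℝ) ≤ k := by exact_mod_cast hk
  have hk0 : (0 : ℝ) < k := by linarith
  have hpow : (2 : ℝ) ^ ((6 : ℝ) * ((k : ℝ) * Real.logb 2 k + Real.logb 2 (1 / ε))) =
      ((k : ℝ) ^ k) ^ 6 * (1 / ε) ^ 6 := by
    rw [mul_comm, Real.rpow_mul (by norm_num), Real.rpow_add (by norm_num), mul_comm (k : ℝ),
      Real.rpow_mul (by norm_num), Real.rpow_logb (by norm_num) (by norm_num) hk0,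
      Real.rpow_logb (by norm_num) (by norm_num) (by positivity), Real.rpow_natCast,
      ← mul_pow]
    exact_mod_cast rfl
  rw [hpow]
  set K : ℝ := (k : ℝ) ^ k with hK
  set u : ℝ := 1 / ε with hu
  have hu1 : 1 ≤ u := by rw [hu, le_div_iff₀ hε0]; linarith
  have hK4 : 4 ≤ K := by
    calc (4 : ℝ) = 2 ^ 2 := by norm_num
      _ ≤ 2 ^ k := pow_le_pow_right₀ (by norm_num) hk
      _ ≤ K := by rw [hK]; gcongr
  have hkK : (k : ℝ) + 1 ≤ 2 * K := by
    have : (k : ℝ) ≤ K := by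
      rw [hK]; exact le_self_pow₀ (by linarith) (by omega)
    linarith
  rw [show 16 * (k + 1) * K ^ 2 / ε ^ 2 * L = 16 * (k + 1) * K ^ 2 * u ^ 2 * L by
    rw [hu]; field_simp]
  have hKK : 16 * ((k : ℝ) + 1) * K ^ 2 + 1 ≤ K ^ 6 := by
    have h1 : 16 * ((k : ℝ) + 1) * K ^ 2 ≤ 32 * K ^ 3 := by nlinarith [sq_nonneg K]
    have h2 : (64 : ℝ) ≤ K ^ 3 := by
      calc (64 : ℝ) = 4 ^ 3 := by norm_num
        _ ≤ K ^ 3 := by gcongr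
    nlinarith
  have hu2 : 1 ≤ u ^ 2 := one_le_pow₀ hu1
  calc 16 * (k + 1) * K ^ 2 * u ^ 2 * L + 1
      ≤ 16 * (k + 1) * K ^ 2 * u ^ 2 * L + u ^ 2 * L := by nlinarith
    _ = (16 * (k + 1) * K ^ 2 + 1) * u ^ 2 * L := by ring
    _ ≤ K ^ 6 * u ^ 6 * L := by
        have : u ^ 2 ≤ u ^ 6 := pow_le_pow_right₀ hu1 (by norm_num)
        gcongr

/-- there is an absolute constant `C > 0` such that for all `2 ≤ k ≤ n` with
`n ≥ 2` and every `1 < δ ≤ 2`, there exists a `δ`-balanced `(n,k)`-family of perfect hash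
functions of size at most `2^{C·(k·log₂ k + log₂(1/(δ−1)))}·log₂ n`. -/
theorem stmt9 :
    ∃ C : ℝ, 0 < C ∧ ∀ n k : ℕ, 2 ≤ k → k ≤ n → 2 ≤ n →
      ∀ δ : ℝ, 1 < δ → δ ≤ 2 →
        ∃ (N : ℕ) (F : Fin N → Fin n → Fin k),
          IsBalancedFamily δ F ∧
          (N : ℝ) ≤ 2 ^ (C * ((k : ℝ) * Real.logb 2 k + Real.logb 2 (1 / (δ - 1)))) *
            Real.logb 2 n := by
  refine ⟨6, by norm_num, fun n k hk hkn hn δ hδ1 hδ2 => ?_⟩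
  obtain ⟨ε, rfl⟩ : ∃ ε, δ = 1 + ε := ⟨δ - 1, by ring⟩
  have hε0 : 0 < ε := by linarith
  have hε1 : ε ≤ 1 := by linarith
  rw [add_sub_cancel_left]
  have hk0 : (0 : ℝ) < k := by exact_mod_cast (by omega : 0 < k)
  have hn' : (2 : ℝ) ≤ n := by exact_mod_cast hn
  have : Nonempty (Fin k) := ⟨⟨0, by omega⟩⟩
  set L := Real.logb 2 n with hL
  have hL1 : 1 ≤ L := by
    rw [hL, Real.le_logb_iff_rpow_le (by norm_num) (by linarith)]
    simpa using hn'
  set p : ℝ := k.factorial / (k : ℝ) ^ k with hp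
  have hp1 : p ≤ 1 := by
    rw [hp, div_le_one (by positivity)]
    exact_mod_cast Nat.factorial_le_pow k
  have hpk : 1 / (k : ℝ) ^ k ≤ p := by
    rw [hp]
    gcongr
    exact_mod_cast Nat.factorial_pos k
  have hp0 : 0 < p := lt_of_lt_of_le (by positivity) hpk
  set l : ℝ := ε * p / 2 with hl
  have hl0 : 0 < l := by positivity
  have hl1 : l ≤ 1 := by rw [hl]; nlinarith
  set B : ℝ := 4 * (k + 1) * L / l ^ 2 with hB
  have hB0 : 0 < B := by positivity
  set N : ℕ := ⌈B⌉₊ with hN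
  have hBN : B ≤ N := Nat.le_ceil B
  have hexp : 2 * (((univ : Finset (Fin n)).powersetCard k).card : ℝ) <
      Real.exp (l ^ 2 / 4 * N) := by
    have hlog : Real.log n < L := by
      have h2 : Real.log 2 < 1 := by linarith [Real.log_two_lt_d9]
      have h3 : Real.log n = L * Real.log 2 := by
        rw [hL, Real.logb, div_mul_cancel₀]
        exact (Real.log_pos (by norm_num)).ne'
      rw [h3]
      nlinarith
    calc 2 * (((univ : Finset (Fin n)).powersetCard k).card : ℝ) ≤ n * (n : ℝ) ^ k := by
          have : (n.choose k : ℝ) ≤ (n : ℝ) ^ k := by exact_mod_cast Nat.choose_le_pow n k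
          rw [card_powersetCard, card_univ, Fintype.card_fin]
          gcongr
      _ = Real.exp (((k + 1 : ℕ) : ℝ) * Real.log n) := by
          rw [Real.exp_nat_mul, Real.exp_log (by linarith), pow_succ']
      _ < Real.exp ((k + 1) * L) := by
          push_cast
          gcongr
      _ = Real.exp (l ^ 2 / 4 * B) := by
          congr 1
          rw [hB]
          field_simp
      _ ≤ _ := by gcongr
  obtain ⟨F, hF⟩ := exists_seq_card_near ((univ : Finset (Fin n)).powersetCard k)
    (fun S => univ.filter fun f : Fin n → Fin k => Set.InjOn f ↑S) p l hp0.le hp1 hl0.le hl1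
    (fun S hS => by
      rw [card_filter_injOn S (mem_powersetCard.1 hS).2, hp, Fintype.card_fun, Fintype.card_fin,
        Fintype.card_fin]
      obtain ⟨m, rfl⟩ := Nat.exists_eq_add_of_le hkn
      rw [Nat.add_sub_cancel_left]
      push_cast
      rw [pow_add]
      field_simp) N hexp
  have hN0 : (0 : ℝ) < N := hB0.trans_le hBN
  refine ⟨N, F, ⟨p * N, by positivity, fun S hS => ?_⟩, ?_⟩
  · have hS' := abs_le.1 (hF S (mem_powersetCard.2 ⟨subset_univ _, hS⟩))
    simp only [mem_filter, mem_univ, true_and] at hS'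
    change -(l * N) ≤ (injCount F S : ℝ) - p * N ∧ (injCount F S : ℝ) - p * N ≤ l * N at hS'
    have hlN : l * N = ε / 2 * (p * N) := by rw [hl]; ring
    have hT : 0 < p * N := by positivity
    rw [hlN] at hS'
    constructor
    · rw [div_le_iff₀ (by linarith)]
      have hX : (1 - ε / 2) * (p * N) ≤ injCount F S := by linarith
      have h1 : 1 ≤ (1 - ε / 2) * (1 + ε) := by nlinarith
      calc p * N ≤ (1 - ε / 2) * (1 + ε) * (p * N) := le_mul_of_one_le_left hT.le h1
        _ = (1 - ε / 2) * (p * N) * (1 + ε) := by ring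
        _ ≤ _ := by gcongr
    · nlinarith [mul_pos hε0 hT]
  · refine le_trans ?_ (size_bound hk hε0 hε1 hL1)
    refine (Nat.ceil_lt_add_one hB0.le).le.trans ?_
    gcongr
    have hB' : B = 16 * (k + 1) * L / ε ^ 2 * (1 / p) ^ 2 := by
      rw [hB, hl]
      field_simp
      norm_num
    have hpinv : 1 / p ≤ (k : ℝ) ^ k := by
      rw [one_div_le hp0 (by positivity)]
      exact hpk
    calc B = 16 * (k + 1) * L / ε ^ 2 * (1 / p) ^ 2 := hB'
      _ ≤ 16 * (k + 1) * L / ε ^ 2 * ((k : ℝ) ^ k) ^ 2 := by gcongr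
      _ = _ := by ring
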